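/- arXiv:1506.03872 — 7 statements merged into one kernel-verified Lean document; each statement's English description precedes it below -/
import Mathlib

section
/- Fix indices i ∈ [m] and j ∈ [n], and define the random variable Z_{ij} on quadruples by Z_{ij}(k',i₀,k,j₀) = sgn(a_{ki}·b_{kj}·a_{k'i})·b_{k'j} if i₀ = i and j₀ = j, and Z_{ij}(k',i₀,k,j₀) = 0 otherwise. Then the expectation of Z_{ij} under the diamond-sampling distribution equals c_{ij}² / ‖W‖₁, where c_{ij} = ∑_{k=1}^d a_{ki}·b_{kj}. -/
open Finset

/-- `sgn x = 1` if `x ≥ 0` and `-1` otherwise. -/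
noncomputable def sgn (x : ℝ) : ℝ := if 0 ≤ x then 1 else -1

theorem abs_mul_sgn (x : ℝ) : |x| * sgn x = x := by
  unfold sgn
  split_ifs with h
  · rw [abs_of_nonneg h, mul_one]
  · rw [abs_of_neg (not_le.mp h), mul_neg_one, neg_neg]

theorem sum_abs_pos {ι : Type*} [Fintype ι] {f : ι → ℝ} (h : ∃ x, f x ≠ 0) :
    0 < ∑ x, |f x| := by
  obtain ⟨x, hx⟩ := h
  exact Finset.sum_pos' (fun _ _ => abs_nonneg _) ⟨x, Finset.mem_univ x, abs_pos.mpr hx⟩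

/-- The expectation under the diamond-sampling distribution of the single-sample
estimator `Z_{ij}` equals `c_{ij}² / ‖W‖₁`. -/
theorem diamond_sampling_expectation
    (d m n : ℕ) (hd : 0 < d) (hm : 0 < m) (hn : 0 < n)
    (A : Matrix (Fin d) (Fin m) ℝ) (B : Matrix (Fin d) (Fin n) ℝ)
    (W1 : ℝ)
    (hW1 : W1 = ∑ k : Fin d, ∑ i : Fin m,
        |A k i| * (∑ k' : Fin d, |A k' i|) * (∑ j : Fin n, |B k j|))
    (hW1pos : 0 < W1)
    (hAcol : ∀ i : Fin m, ∃ k : Fin d, A k i ≠ 0)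
    (hBrow : ∀ k : Fin d, ∃ j : Fin n, B k j ≠ 0)
    (p : Fin d × Fin m × Fin d × Fin n → ℝ)
    (hp : ∀ (l' : Fin d) (i0 : Fin m) (l : Fin d) (j0 : Fin n),
        p (l', i0, l, j0)
          = ((|A l i0| * (∑ k'' : Fin d, |A k'' i0|) * (∑ j' : Fin n, |B l j'|)) / W1)
            * (|B l j0| / (∑ j' : Fin n, |B l j'|))
            * (|A l' i0| / (∑ k'' : Fin d, |A k'' i0|)))
    (i : Fin m) (j : Fin n)
    (Z : Fin d × Fin m × Fin d × Fin n → ℝ)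
    (hZ : ∀ (l' : Fin d) (i0 : Fin m) (l : Fin d) (j0 : Fin n),
        Z (l', i0, l, j0)
          = if i0 = i ∧ j0 = j then sgn (A l i * B l j * A l' i) * B l' j else 0) :
    ∑ q : Fin d × Fin m × Fin d × Fin n, p q * Z q
      = (∑ k : Fin d, A k i * B k j) ^ 2 / W1 := by
  have hterm : ∀ (l' : Fin d) (i0 : Fin m) (l : Fin d) (j0 : Fin n),
      p (l', i0, l, j0) * Z (l', i0, l, j0)
        = if i0 = i then if j0 = j then
            (A l' i * B l' j) * (A l i * B l j) / W1 else 0 else 0 := by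
    intro l' i0 l j0
    rw [hp, hZ, ite_and]
    split_ifs with hi hj
    · subst hi hj
      have hS := (sum_abs_pos (hAcol i0)).ne'
      have hT := (sum_abs_pos (hBrow l)).ne'
      have hsgn := abs_mul_sgn (A l i0 * B l j0 * A l' i0)
      rw [abs_mul, abs_mul] at hsgn
      field_simp
      linear_combination B l' j0 * hsgn
    · rw [mul_zero]
    · rw [mul_zero]
  simp only [Fintype.sum_prod_type, hterm, Finset.sum_ite_irrel, Finset.sum_const_zero,
    Finset.sum_ite_eq', Finset.mem_univ, if_true]
  rw [sq, Finset.sum_mul_sum, Finset.sum_div]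
  simp only [Finset.sum_div]
end

section
/- Fix a threshold τ > 0 and an error probability δ ∈ (0,1). Assume all entries of A and B are nonnegative and at most K. Let ω_1, …, ω_s be s independent samples from the diamond-sampling distribution, and for each pair (i,j) set x_{ij} = ∑_{ℓ=1}^s Z_{ij}(ω_ℓ), where Z_{ij}(k',i₀,k,j₀) = b_{k'j} if i₀ = i and j₀ = j, and 0 otherwise. If s ≥ 12·K·‖W‖₁·log(2mn/δ) / τ², then with probability at least 1 − δ the following holds simultaneously for all index pairs (i,j) and (i',j'): if c_{ij} > τ and c_{i'j'} < τ/4, then x_{ij} > x_{i'j'}. -/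
open Finset
open scoped Classical

/-- Chernoff bound for a sum of i.i.d. `[0, 1]`-valued variables on a finite probability space,
with an arbitrary exponent `r` (the lower tail for `r < 0`, the upper tail for `0 < r`). -/
lemma chernoff_sum_prod_le {Ω : Type*} [Fintype Ω] {p Y : Ω → ℝ} (hp0 : ∀ x, 0 ≤ p x)
    (hp1 : ∑ x, p x = 1) (hY0 : ∀ x, 0 ≤ Y x) (hY1 : ∀ x, Y x ≤ 1) (s : ℕ) (r a : ℝ)
    (Q : (Fin s → Ω) → Prop) [DecidablePred Q] (hQ : ∀ ω, Q ω → r * a ≤ r * ∑ l, Y (ω l)) :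
    ∑ ω with Q ω, ∏ l, p (ω l)
      ≤ Real.exp (s * (∑ x, p x * Y x) * (Real.exp r - 1) - r * a) := by
  have hmgf : ∑ x, p x * Real.exp (r * Y x)
      ≤ Real.exp ((∑ x, p x * Y x) * (Real.exp r - 1)) := by
    have hconv : ∀ x, Real.exp (r * Y x) ≤ 1 + Y x * (Real.exp r - 1) := fun x ↦ by
      have h := convexOn_exp.2 (Set.mem_univ 0) (Set.mem_univ r) (sub_nonneg.2 (hY1 x)) (hY0 x)
        (by ring)
      simp only [smul_eq_mul, mul_zero, zero_add, Real.exp_zero, mul_one] at h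
      rw [mul_comm r]
      linarith
    calc ∑ x, p x * Real.exp (r * Y x)
        ≤ ∑ x, p x * (1 + Y x * (Real.exp r - 1)) :=
          sum_le_sum fun x _ ↦ mul_le_mul_of_nonneg_left (hconv x) (hp0 x)
      _ = (∑ x, p x * Y x) * (Real.exp r - 1) + 1 := by
          simp only [mul_add, mul_one, sum_add_distrib, hp1, sum_mul, mul_assoc, add_comm]
      _ ≤ _ := Real.add_one_le_exp _
  have hprod0 : ∀ ω : Fin s → Ω, 0 ≤ ∏ l, p (ω l) := fun ω ↦ prod_nonneg fun l _ ↦ hp0 _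
  calc ∑ ω with Q ω, ∏ l, p (ω l)
      ≤ ∑ ω with Q ω, Real.exp (-(r * a)) * ∏ l, p (ω l) * Real.exp (r * Y (ω l)) := by
        refine sum_le_sum fun ω hω ↦ ?_
        rw [prod_mul_distrib, ← Real.exp_sum, ← mul_sum, mul_left_comm, ← Real.exp_add]
        refine le_mul_of_one_le_right (hprod0 ω) (Real.one_le_exp ?_)
        linarith [hQ ω (mem_filter.1 hω).2]
    _ ≤ ∑ ω : Fin s → Ω, Real.exp (-(r * a)) * ∏ l, p (ω l) * Real.exp (r * Y (ω l)) :=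
        sum_le_sum_of_subset_of_nonneg (filter_subset _ _) fun ω _ _ ↦
          mul_nonneg (Real.exp_nonneg _)
            (prod_nonneg fun l _ ↦ mul_nonneg (hp0 _) (Real.exp_nonneg _))
    _ = Real.exp (-(r * a)) * (∑ x, p x * Real.exp (r * Y x)) ^ s := by
        rw [← mul_sum, Fintype.sum_pow]
    _ ≤ Real.exp (-(r * a)) * Real.exp ((∑ x, p x * Y x) * (Real.exp r - 1)) ^ s := by
        gcongr
        exact sum_nonneg fun x _ ↦ mul_nonneg (hp0 x) (Real.exp_nonneg _)
    _ = _ := by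
        rw [← Real.exp_nat_mul, ← Real.exp_add]
        congr 1
        ring

/-- Union bound for a finite weighted sum. -/
lemma sum_filter_le_sum_sum_filter {Ω ι : Type*} [Fintype Ω] [Fintype ι] {f : Ω → ℝ}
    (hf : ∀ x, 0 ≤ f x) (P : Ω → Prop) (Q : ι → Ω → Prop) [DecidablePred P]
    [∀ i, DecidablePred (Q i)] (h : ∀ x, P x → ∃ i, Q i x) :
    ∑ x with P x, f x ≤ ∑ i, ∑ x with Q i x, f x := by
  simp only [sum_filter]
  rw [sum_comm]
  refine sum_le_sum fun x _ ↦ ?_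
  have h0 : ∀ i ∈ univ, 0 ≤ if Q i x then f x else 0 := fun i _ ↦ by
    split_ifs
    exacts [hf x, le_rfl]
  split_ifs with hx
  · obtain ⟨i, hi⟩ := h x hx
    simpa [hi] using single_le_sum h0 (mem_univ i)
  · exact sum_nonneg h0

/-- Separation theorem: with `s ≥ 12K‖W‖₁ log(2mn/δ)/τ²` i.i.d. diamond samples,
with probability at least `1 - δ`, simultaneously for all pairs `(i,j)` and `(i',j')`,
if `c_{ij} > τ` and `c_{i'j'} < τ/4` then `x_{ij} > x_{i'j'}`. -/
theorem diamond_sampling_separation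
    (d m n : ℕ) (hd : 0 < d) (hm : 0 < m) (hn : 0 < n)
    (A : Matrix (Fin d) (Fin m) ℝ) (B : Matrix (Fin d) (Fin n) ℝ)
    (K : ℝ)
    (hA0 : ∀ k i, 0 ≤ A k i) (hAK : ∀ k i, A k i ≤ K)
    (hB0 : ∀ k j, 0 ≤ B k j) (hBK : ∀ k j, B k j ≤ K)
    (W1 : ℝ)
    (hW1 : W1 = ∑ k : Fin d, ∑ i : Fin m,
        |A k i| * (∑ k' : Fin d, |A k' i|) * (∑ j : Fin n, |B k j|))
    (hW1pos : 0 < W1)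
    (hAcol : ∀ i : Fin m, ∃ k : Fin d, A k i ≠ 0)
    (hBrow : ∀ k : Fin d, ∃ j : Fin n, B k j ≠ 0)
    (p : Fin d × Fin m × Fin d × Fin n → ℝ)
    (hp : ∀ (l' : Fin d) (i0 : Fin m) (l : Fin d) (j0 : Fin n),
        p (l', i0, l, j0)
          = ((|A l i0| * (∑ k'' : Fin d, |A k'' i0|) * (∑ j' : Fin n, |B l j'|)) / W1)
            * (|B l j0| / (∑ j' : Fin n, |B l j'|))
            * (|A l' i0| / (∑ k'' : Fin d, |A k'' i0|)))
    (Z : Fin m → Fin n → Fin d × Fin m × Fin d × Fin n → ℝ)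
    (hZ : ∀ (i : Fin m) (j : Fin n) (l' : Fin d) (i0 : Fin m) (l : Fin d) (j0 : Fin n),
        Z i j (l', i0, l, j0) = if i0 = i ∧ j0 = j then B l' j else 0)
    (τ δ : ℝ) (hτ : 0 < τ) (hδ0 : 0 < δ) (hδ1 : δ < 1)
    (s : ℕ)
    (hs : (s : ℝ) ≥ 12 * K * W1 * Real.log (2 * m * n / δ) / τ ^ 2) :
    (∑ ω ∈ Finset.univ.filter
        (fun ω : Fin s → Fin d × Fin m × Fin d × Fin n =>
          ∀ (i : Fin m) (j : Fin n) (i' : Fin m) (j' : Fin n),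
            (∑ k : Fin d, A k i * B k j) > τ →
            (∑ k : Fin d, A k i' * B k j') < τ / 4 →
            (∑ ℓ : Fin s, Z i j (ω ℓ)) > (∑ ℓ : Fin s, Z i' j' (ω ℓ))),
      ∏ ℓ : Fin s, p (ω ℓ)) ≥ 1 - δ := by
  obtain ⟨k₁, hk₁⟩ := hAcol ⟨0, hm⟩
  have hK : 0 < K := (lt_of_le_of_ne (hA0 _ _) hk₁.symm).trans_le (hAK _ _)
  have hcol : ∀ i, 0 < ∑ k, A k i := fun i ↦ by
    obtain ⟨k, hk⟩ := hAcol i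
    exact sum_pos' (fun k _ ↦ hA0 k i) ⟨k, mem_univ k, lt_of_le_of_ne (hA0 k i) hk.symm⟩
  have hrow : ∀ k, 0 < ∑ j, B k j := fun k ↦ by
    obtain ⟨j, hj⟩ := hBrow k
    exact sum_pos' (fun j _ ↦ hB0 k j) ⟨j, mem_univ j, lt_of_le_of_ne (hB0 k j) hj.symm⟩
  simp only [abs_of_nonneg (hA0 _ _), abs_of_nonneg (hB0 _ _)] at hp hW1
  have hp' : ∀ l' i l j, p (l', i, l, j) = A l' i * A l i * B l j / W1 := fun l' i l j ↦ by
    rw [hp]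
    have := (hcol i).ne'
    have := (hrow l).ne'
    field_simp
  have hp0 : ∀ x, 0 ≤ p x := by
    rintro ⟨l', i, l, j⟩
    rw [hp']
    exact div_nonneg (mul_nonneg (mul_nonneg (hA0 _ _) (hA0 _ _)) (hB0 _ _)) hW1pos.le
  have hp1 : ∑ x, p x = 1 := by
    simp only [Fintype.sum_prod_type, hp', ← sum_div]
    rw [div_eq_one_iff_eq hW1pos.ne', hW1, sum_comm]
    conv_rhs => rw [sum_comm]
    refine sum_congr rfl fun i _ ↦ ?_
    rw [sum_comm]
    refine sum_congr rfl fun l _ ↦ ?_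
    simp only [← mul_sum, ← sum_mul]
    ring
  have hZ0 : ∀ i j x, 0 ≤ Z i j x / K := by
    rintro i j ⟨l', i', l, j'⟩
    rw [hZ]
    split_ifs
    exacts [div_nonneg (hB0 _ _) hK.le, (zero_div K).ge]
  have hZ1 : ∀ i j x, Z i j x / K ≤ 1 := by
    rintro i j ⟨l', i', l, j'⟩
    rw [hZ, div_le_one hK]
    split_ifs
    exacts [hBK _ _, hK.le]
  have hEZ : ∀ i j, ∑ x, p x * (Z i j x / K) = (∑ k, A k i * B k j) ^ 2 / (K * W1) := by
    intro i j
    have : ∀ l' i' l j', p (l', i', l, j') * (Z i j (l', i', l, j') / K)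
        = if i' = i then if j' = j then A l' i * B l' j * (A l i * B l j) / (K * W1) else 0
          else 0 := fun l' i' l j' ↦ by
      rw [hp', hZ]
      by_cases hi : i' = i
      · by_cases hj : j' = j
        · rw [if_pos ⟨hi, hj⟩, if_pos hi, if_pos hj, hi, hj, div_mul_div_comm, mul_comm W1]
          ring
        · rw [if_neg (hj ·.2), if_pos hi, if_neg hj, zero_div, mul_zero]
      · rw [if_neg (hi ·.1), if_neg hi, zero_div, mul_zero]
    simp only [Fintype.sum_prod_type, this]
    rw [sq, sum_mul_sum, sum_div]
    refine sum_congr rfl fun l' _ ↦ ?_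
    rw [sum_comm, sum_div]
    refine sum_congr rfl fun l _ ↦ ?_
    rw [sum_comm]
    simp
  set M : ℝ := s * τ ^ 2 / (K * W1) with hM
  set L : ℝ := Real.log (2 * m * n / δ) with hL
  have hm' : (1 : ℝ) ≤ m := by exact_mod_cast hm
  have hn' : (1 : ℝ) ≤ n := by exact_mod_cast hn
  have hmn : (1 : ℝ) ≤ m * n := one_le_mul_of_one_le_of_one_le hm' hn'
  have hL0 : 0 < L := Real.log_pos (by rw [one_lt_div hδ0]; nlinarith)
  have hML : 12 * L ≤ M := by
    rw [hM, le_div_iff₀ (by positivity)]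
    rw [ge_iff_le, div_le_iff₀ (by positivity)] at hs
    linarith
  have he1 := Real.exp_one_lt_d9
  have he2 : Real.exp (-1) < 0.4 := by
    rw [Real.exp_neg, inv_lt_comm₀ (Real.exp_pos 1) (by norm_num)]
    linarith [Real.exp_one_gt_d9]
  have hmean : ∀ i j, (s : ℝ) * (∑ x, p x * (Z i j x / K))
      = s * (∑ k, A k i * B k j) ^ 2 / (K * W1) := fun i j ↦ by
    rw [hEZ, mul_div_assoc]
  have hfail : ∀ ij : Fin m × Fin n,
      ∑ ω : Fin s → Fin d × Fin m × Fin d × Fin n with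
        (τ < ∑ k, A k ij.1 * B k ij.2 ∧ ∑ l, Z ij.1 ij.2 (ω l) / K ≤ M / 2) ∨
        (∑ k, A k ij.1 * B k ij.2 < τ / 4 ∧ M / 2 ≤ ∑ l, Z ij.1 ij.2 (ω l) / K),
        ∏ l, p (ω l) ≤ Real.exp (-L) := by
    rintro ⟨i, j⟩
    have hc0 : 0 ≤ ∑ k, A k i * B k j := sum_nonneg fun k _ ↦ mul_nonneg (hA0 _ _) (hB0 _ _)
    rcases lt_or_ge τ (∑ k, A k i * B k j) with hc | hc
    · refine (chernoff_sum_prod_le hp0 hp1 (hZ0 i j) (hZ1 i j) s (-1) (M / 2) _ ?_).trans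
        (Real.exp_le_exp.2 ?_)
      · rintro ω (h | h)
        · linarith [h.2]
        · linarith [h.1]
      · have hμ : M ≤ s * ∑ x, p x * (Z i j x / K) := by
          rw [hmean, hM]
          gcongr
        nlinarith
    rcases lt_or_ge (∑ k, A k i * B k j) (τ / 4) with hc' | hc'
    · refine (chernoff_sum_prod_le hp0 hp1 (hZ0 i j) (hZ1 i j) s 1 (M / 2) _ ?_).trans
        (Real.exp_le_exp.2 ?_)
      · rintro ω (h | h)
        · linarith [h.1]
        · linarith [h.2]
      · have hμ : s * ∑ x, p x * (Z i j x / K) ≤ M / 16 := by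
          rw [hmean]
          calc s * (∑ k, A k i * B k j) ^ 2 / (K * W1) ≤ s * (τ / 4) ^ 2 / (K * W1) := by gcongr
            _ = M / 16 := by ring
        have := mul_le_mul_of_nonneg_right hμ (sub_nonneg.2 (Real.one_le_exp zero_le_one))
        nlinarith
    · rw [filter_false_of_mem, sum_empty]
      · exact Real.exp_nonneg _
      · rintro ω - (h | h)
        · linarith [h.1]
        · linarith [h.1]
  have hprod0 : ∀ ω : Fin s → Fin d × Fin m × Fin d × Fin n, 0 ≤ ∏ l, p (ω l) :=
    fun ω ↦ prod_nonneg fun l _ ↦ hp0 _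
  have htot : ∑ ω : Fin s → Fin d × Fin m × Fin d × Fin n, ∏ l, p (ω l) = 1 := by
    rw [← Fintype.sum_pow, hp1, one_pow]
  rw [← sum_filter_add_sum_filter_not univ (fun ω : Fin s → Fin d × Fin m × Fin d × Fin n ↦
    ∀ (i : Fin m) (j : Fin n) (i' : Fin m) (j' : Fin n),
      (∑ k : Fin d, A k i * B k j) > τ → (∑ k : Fin d, A k i' * B k j') < τ / 4 →
      (∑ l : Fin s, Z i j (ω l)) > (∑ l : Fin s, Z i' j' (ω l)))] at htot
  have hunion := (sum_filter_le_sum_sum_filter hprod0 (fun ω ↦ ¬ ∀ (i : Fin m) (j : Fin n)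
      (i' : Fin m) (j' : Fin n),
      (∑ k : Fin d, A k i * B k j) > τ → (∑ k : Fin d, A k i' * B k j') < τ / 4 →
      (∑ l : Fin s, Z i j (ω l)) > (∑ l : Fin s, Z i' j' (ω l))) _ (fun ω hω ↦ ?_)).trans
    (sum_le_sum fun ij _ ↦ hfail ij)
  · have hexp : Real.exp (-L) = δ / (2 * m * n) := by
      rw [Real.exp_neg, hL, Real.exp_log (by positivity), inv_div]
    rw [sum_const, card_univ, Fintype.card_prod, Fintype.card_fin, Fintype.card_fin, nsmul_eq_mul,
      hexp] at hunion
    have : ((m * n : ℕ) : ℝ) * (δ / (2 * m * n)) = δ / 2 := by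
      push_cast
      field_simp
    linarith
  · push Not at hω
    obtain ⟨i, j, i', j', hc, hc', hle⟩ := hω
    rcases le_total (∑ l, Z i j (ω l) / K) (M / 2) with h | h
    · exact ⟨(i, j), Or.inl ⟨hc, h⟩⟩
    · refine ⟨(i', j'), Or.inr ⟨hc', h.trans ?_⟩⟩
      simp only [← sum_div]
      gcongr
end

section
/- (Upper-tail step in the separation theorem.) Fix τ > 0, δ ∈ (0,1), and indices (i,j) with c_{ij} > τ. Assume all entries of A and B are nonnegative and at most K. Let ω_1, …, ω_s be s independent samples from the diamond-sampling distribution and set x_{ij} = ∑_{ℓ=1}^s Z_{ij}(ω_ℓ), where Z_{ij}(k',i₀,k,j₀) = b_{k'j} if i₀ = i and j₀ = j, and 0 otherwise. If s ≥ 12·K·‖W‖₁·log(2mn/δ) / τ², then with probability at least 1 − δ/(mn) one has x_{ij}·‖W‖₁/s ≥ τ²/2. -/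
open Finset
open scoped Classical

/-- The exponential moment bound `exp (-y / 2) ≤ 1 - y / 3` on the unit interval. -/
lemma exp_neg_half_le {y : ℝ} (h0 : 0 ≤ y) (h1 : y ≤ 1) :
    Real.exp (-(y / 2)) ≤ 1 - y / 3 := by
  rw [Real.exp_neg]
  have h : 1 + y / 2 ≤ Real.exp (y / 2) := by linarith [Real.add_one_le_exp (y / 2)]
  calc (Real.exp (y / 2))⁻¹ ≤ (1 + y / 2)⁻¹ := inv_anti₀ (by linarith) h
    _ ≤ 1 - y / 3 := by
      rw [inv_le_iff_one_le_mul₀ (by linarith)]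
      nlinarith

/-- A Chernoff bound for the lower tail of a sum of `s` independent copies of a `[0, 1]`-valued
variable on a finite probability space. -/
lemma sum_prod_lower_tail_le {Ω : Type*} [Fintype Ω] (p Y : Ω → ℝ)
    (hp0 : ∀ x, 0 ≤ p x) (hp1 : ∑ x, p x = 1) (hY0 : ∀ x, 0 ≤ Y x) (hY1 : ∀ x, Y x ≤ 1)
    {θ : ℝ} (hθ : θ ≤ ∑ x, p x * Y x) (s : ℕ) (S : Finset (Fin s → Ω))
    (hS : ∀ ω ∈ S, ∑ ℓ, Y (ω ℓ) ≤ s * θ / 2) :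
    ∑ ω ∈ S, ∏ ℓ, p (ω ℓ) ≤ Real.exp (-(s * θ / 12)) := by
  have hmgf : ∑ x, p x * Real.exp (-(Y x / 2)) ≤ Real.exp (-(θ / 3)) := by
    calc ∑ x, p x * Real.exp (-(Y x / 2)) ≤ ∑ x, (p x - p x * Y x / 3) := by
          refine Finset.sum_le_sum fun x _ => ?_
          nlinarith [mul_le_mul_of_nonneg_left (exp_neg_half_le (hY0 x) (hY1 x)) (hp0 x)]
      _ = 1 - (∑ x, p x * Y x) / 3 := by
          rw [Finset.sum_sub_distrib, hp1, Finset.sum_div]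
      _ ≤ -(θ / 3) + 1 := by linarith
      _ ≤ Real.exp (-(θ / 3)) := Real.add_one_le_exp _
  have hprod0 (ω : Fin s → Ω) : 0 ≤ ∏ ℓ, p (ω ℓ) := Finset.prod_nonneg fun ℓ _ => hp0 _
  calc ∑ ω ∈ S, ∏ ℓ, p (ω ℓ)
      ≤ ∑ ω ∈ S, Real.exp (s * θ / 4) * ∏ ℓ, (p (ω ℓ) * Real.exp (-(Y (ω ℓ) / 2))) := by
        refine Finset.sum_le_sum fun ω hω => ?_
        rw [Finset.prod_mul_distrib, ← Real.exp_sum, mul_left_comm, ← Real.exp_add]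
        refine le_mul_of_one_le_right (hprod0 ω) (Real.one_le_exp ?_)
        rw [Finset.sum_neg_distrib, ← Finset.sum_div]
        linarith [hS ω hω]
    _ ≤ ∑ ω : Fin s → Ω, Real.exp (s * θ / 4) *
          ∏ ℓ, (p (ω ℓ) * Real.exp (-(Y (ω ℓ) / 2))) := by
        refine Finset.sum_le_sum_of_subset_of_nonneg (Finset.subset_univ S) fun ω _ _ => ?_
        exact mul_nonneg (Real.exp_nonneg _)
          (Finset.prod_nonneg fun ℓ _ => mul_nonneg (hp0 _) (Real.exp_nonneg _))
    _ = Real.exp (s * θ / 4) * (∑ x, p x * Real.exp (-(Y x / 2))) ^ s := by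
        rw [← Finset.mul_sum, Fintype.sum_pow]
    _ ≤ Real.exp (s * θ / 4) * Real.exp (-(θ / 3)) ^ s := by
        gcongr
        exact Finset.sum_nonneg fun x _ => mul_nonneg (hp0 _) (Real.exp_nonneg _)
    _ = Real.exp (-(s * θ / 12)) := by
        rw [← Real.exp_nat_mul, ← Real.exp_add]
        ring_nf

/-- Upper-tail step in the separation theorem: if `c_{ij} > τ` and
`s ≥ 12K‖W‖₁ log(2mn/δ)/τ²`, then with probability at least `1 - δ/(mn)`,
`x_{ij}‖W‖₁/s ≥ τ²/2`. -/
theorem diamond_sampling_upper_tail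
    (d m n : ℕ) (hd : 0 < d) (hm : 0 < m) (hn : 0 < n)
    (A : Matrix (Fin d) (Fin m) ℝ) (B : Matrix (Fin d) (Fin n) ℝ)
    (K : ℝ)
    (hA0 : ∀ k i, 0 ≤ A k i) (hAK : ∀ k i, A k i ≤ K)
    (hB0 : ∀ k j, 0 ≤ B k j) (hBK : ∀ k j, B k j ≤ K)
    (W1 : ℝ)
    (hW1 : W1 = ∑ k : Fin d, ∑ i : Fin m,
        |A k i| * (∑ k' : Fin d, |A k' i|) * (∑ j : Fin n, |B k j|))
    (hW1pos : 0 < W1)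
    (hAcol : ∀ i : Fin m, ∃ k : Fin d, A k i ≠ 0)
    (hBrow : ∀ k : Fin d, ∃ j : Fin n, B k j ≠ 0)
    (p : Fin d × Fin m × Fin d × Fin n → ℝ)
    (hp : ∀ (l' : Fin d) (i0 : Fin m) (l : Fin d) (j0 : Fin n),
        p (l', i0, l, j0)
          = ((|A l i0| * (∑ k'' : Fin d, |A k'' i0|) * (∑ j' : Fin n, |B l j'|)) / W1)
            * (|B l j0| / (∑ j' : Fin n, |B l j'|))
            * (|A l' i0| / (∑ k'' : Fin d, |A k'' i0|)))
    (i : Fin m) (j : Fin n)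
    (Z : Fin d × Fin m × Fin d × Fin n → ℝ)
    (hZ : ∀ (l' : Fin d) (i0 : Fin m) (l : Fin d) (j0 : Fin n),
        Z (l', i0, l, j0) = if i0 = i ∧ j0 = j then B l' j else 0)
    (τ δ : ℝ) (hτ : 0 < τ) (hδ0 : 0 < δ) (hδ1 : δ < 1)
    (hcij : (∑ k : Fin d, A k i * B k j) > τ)
    (s : ℕ)
    (hs : (s : ℝ) ≥ 12 * K * W1 * Real.log (2 * m * n / δ) / τ ^ 2) :
    (∑ ω ∈ Finset.univ.filter
        (fun ω : Fin s → Fin d × Fin m × Fin d × Fin n =>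
          (∑ ℓ : Fin s, Z (ω ℓ)) * W1 / (s : ℝ) ≥ τ ^ 2 / 2),
      ∏ ℓ : Fin s, p (ω ℓ)) ≥ 1 - δ / (m * n) := by
  have hW1ne : W1 ≠ 0 := hW1pos.ne'
  have hAsum (i0 : Fin m) : (∑ k, |A k i0|) ≠ 0 := by
    obtain ⟨k, hk⟩ := hAcol i0
    exact (Finset.sum_pos' (fun _ _ => abs_nonneg _)
      ⟨k, Finset.mem_univ k, abs_pos.mpr hk⟩).ne'
  have hBsum (k : Fin d) : (∑ j', |B k j'|) ≠ 0 := by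
    obtain ⟨j', hj⟩ := hBrow k
    exact (Finset.sum_pos' (fun _ _ => abs_nonneg _)
      ⟨j', Finset.mem_univ j', abs_pos.mpr hj⟩).ne'
  have hp' (l' : Fin d) (i0 : Fin m) (l : Fin d) (j0 : Fin n) :
      p (l', i0, l, j0) = A l i0 * B l j0 * A l' i0 / W1 := by
    have h1 := hAsum i0
    have h2 := hBsum l
    rw [hp, abs_of_nonneg (hA0 l i0), abs_of_nonneg (hA0 l' i0), abs_of_nonneg (hB0 l j0)]
    field_simp
  have hp0 (x) : 0 ≤ p x := by
    obtain ⟨l', i0, l, j0⟩ := x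
    rw [hp']
    have := hA0 l i0
    have := hA0 l' i0
    have := hB0 l j0
    positivity
  have hp1 : ∑ x, p x = 1 := by
    simp only [Fintype.sum_prod_type, hp', ← Finset.sum_div]
    rw [div_eq_one_iff_eq hW1ne, hW1]
    simp only [abs_of_nonneg (hA0 _ _), abs_of_nonneg (hB0 _ _)]
    rw [Finset.sum_comm, Finset.sum_comm (s := univ (α := Fin d)) (t := univ (α := Fin m))]
    refine Finset.sum_congr rfl fun i0 _ => ?_
    rw [Finset.sum_comm]
    refine Finset.sum_congr rfl fun l _ => ?_
    simp only [Finset.mul_sum, Finset.sum_mul]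
    rw [Finset.sum_comm]
    exact Finset.sum_congr rfl fun _ _ => Finset.sum_congr rfl fun _ _ => by ring
  have hEZ : ∑ x, p x * Z x = (∑ k, A k i * B k j) ^ 2 / W1 := by
    simp only [Fintype.sum_prod_type, hp', hZ, ite_and, mul_ite, mul_zero,
      Finset.sum_ite_irrel, Finset.sum_const_zero, Finset.sum_ite_eq', Finset.mem_univ, if_true]
    rw [sq, Finset.sum_mul_sum, Finset.sum_div]
    refine Finset.sum_congr rfl fun l' _ => ?_
    rw [Finset.sum_div]
    exact Finset.sum_congr rfl fun _ _ => by ring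
  have hK : 0 < K := by
    refine lt_of_le_of_ne ((hA0 ⟨0, hd⟩ i).trans (hAK _ _)) fun hK0 => ?_
    have hzero : ∑ k, A k i * B k j = 0 := Finset.sum_eq_zero fun k _ => by
      rw [le_antisymm (hK0 ▸ hAK k i) (hA0 k i), zero_mul]
    linarith
  have hZ0 (x) : 0 ≤ Z x := by
    obtain ⟨l', i0, l, j0⟩ := x
    rw [hZ]
    split_ifs
    exacts [hB0 _ _, le_rfl]
  have hZK (x) : Z x ≤ K := by
    obtain ⟨l', i0, l, j0⟩ := x
    rw [hZ]
    split_ifs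
    exacts [hBK _ _, hK.le]
  have hmR : (1 : ℝ) ≤ m := by exact_mod_cast hm
  have hnR : (1 : ℝ) ≤ n := by exact_mod_cast hn
  have hmn : (1 : ℝ) ≤ m * n := one_le_mul_of_one_le_of_one_le hmR hnR
  have harg : 1 < 2 * m * n / δ := by
    rw [one_lt_div hδ0]
    nlinarith
  have hs0 : (0 : ℝ) < s := by
    have := Real.log_pos harg
    exact lt_of_lt_of_le (by positivity) hs
  have htail := sum_prod_lower_tail_le p (fun x => Z x / K) hp0 hp1
    (fun x => div_nonneg (hZ0 x) hK.le) (fun x => (div_le_one hK).mpr (hZK x))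
    (θ := τ ^ 2 / W1 / K)
    (by
      simp only [← mul_div_assoc, ← Finset.sum_div, hEZ]
      gcongr)
    s (univ.filter fun ω => ¬ (∑ ℓ : Fin s, Z (ω ℓ)) * W1 / (s : ℝ) ≥ τ ^ 2 / 2)
    (by
      intro ω hω
      have h := not_le.mp (Finset.mem_filter.mp hω).2
      rw [div_lt_iff₀ hs0] at h
      have hsum : ∑ ℓ, Z (ω ℓ) ≤ τ ^ 2 / 2 * s / W1 := ((lt_div_iff₀ hW1pos).mpr h).le
      rw [← Finset.sum_div]
      calc (∑ ℓ, Z (ω ℓ)) / K ≤ τ ^ 2 / 2 * s / W1 / K := by gcongr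
        _ = s * (τ ^ 2 / W1 / K) / 2 := by ring)
  have hbound : Real.exp (-(s * (τ ^ 2 / W1 / K) / 12)) ≤ δ / (m * n) := by
    have hlog : Real.log (2 * m * n / δ) ≤ s * (τ ^ 2 / W1 / K) / 12 := by
      rw [ge_iff_le, div_le_iff₀ (by positivity)] at hs
      have hrw : s * (τ ^ 2 / W1 / K) / 12 = s * τ ^ 2 / (12 * K * W1) := by
        field_simp
      rw [hrw, le_div_iff₀ (by positivity)]
      linarith
    calc Real.exp (-(s * (τ ^ 2 / W1 / K) / 12))
        ≤ Real.exp (-Real.log (2 * m * n / δ)) := Real.exp_le_exp.mpr (neg_le_neg hlog)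
      _ = δ / (2 * m * n) := by
          rw [Real.exp_neg, Real.exp_log (by linarith), inv_div]
      _ ≤ δ / (m * n) := by
          gcongr
          linarith
  have htotal : ∑ ω : Fin s → Fin d × Fin m × Fin d × Fin n, ∏ ℓ, p (ω ℓ) = 1 := by
    rw [← Fintype.sum_pow, hp1, one_pow]
  rw [← Finset.sum_filter_add_sum_filter_not univ
    (fun ω : Fin s → Fin d × Fin m × Fin d × Fin n =>
      (∑ ℓ : Fin s, Z (ω ℓ)) * W1 / (s : ℝ) ≥ τ ^ 2 / 2)] at htotal
  linarith
end

section
/- (Lower-tail step in the separation theorem.) Fix τ > 0, δ ∈ (0,1), and indices (i',j') with c_{i'j'} < τ/4. Assume all entries of A and B are nonnegative and at most K. Let ω_1, …, ω_s be s independent samples from the diamond-sampling distribution and set x_{i'j'} = ∑_{ℓ=1}^s Z_{i'j'}(ω_ℓ), where Z_{i'j'}(k',i₀,k,j₀) = b_{k'j₀} if i₀ = i' and j₀ = j', and 0 otherwise. If s ≥ 12·K·‖W‖₁·log(2mn/δ) / τ², then Pr[ x_{i'j'}·‖W‖₁/s > τ²/2 ] < δ/(2mn). -/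
open Finset
open scoped Classical

/-- An exponential Markov bound: if `p` is a probability mass function and `0 ≤ Z ≤ K`, then the
`s`-fold product measure of any event on which `t ≤ ∑ Z` is at most
`exp ((2 * s * E[Z] - t) / K)`. -/
theorem sum_prod_le_exp_of_le_sum {α : Type*} [Fintype α] {p Z : α → ℝ} {K t : ℝ} {s : ℕ}
    (hp : ∀ x, 0 ≤ p x) (hp1 : ∑ x, p x = 1) (hK : 0 < K)
    (hZ0 : ∀ x, 0 ≤ Z x) (hZK : ∀ x, Z x ≤ K)
    (S : Finset (Fin s → α)) (hS : ∀ ω ∈ S, t ≤ ∑ l, Z (ω l)) :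
    ∑ ω ∈ S, ∏ l, p (ω l) ≤ Real.exp ((2 * s * (∑ x, p x * Z x) - t) / K) := by
  have hmgf : ∑ x, p x * Real.exp (Z x / K) ≤ Real.exp (2 * (∑ x, p x * Z x) / K) := by
    have hexp : ∀ x, Real.exp (Z x / K) ≤ 1 + 2 * (Z x / K) := fun x => by
      have h0 : 0 ≤ Z x / K := div_nonneg (hZ0 x) hK.le
      have h1 : Z x / K ≤ 1 := (div_le_one hK).2 (hZK x)
      have h := (abs_le.1 (Real.abs_exp_sub_one_sub_id_le (abs_le.2 ⟨by linarith, h1⟩))).2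
      nlinarith
    calc ∑ x, p x * Real.exp (Z x / K)
        ≤ ∑ x, (p x + p x * Z x * (2 / K)) := Finset.sum_le_sum fun x _ =>
          (mul_le_mul_of_nonneg_left (hexp x) (hp x)).trans_eq (by ring)
      _ = 2 * (∑ x, p x * Z x) / K + 1 := by
          rw [Finset.sum_add_distrib, hp1, ← Finset.sum_mul]; ring
      _ ≤ _ := Real.add_one_le_exp _
  calc ∑ ω ∈ S, ∏ l, p (ω l)
      ≤ ∑ ω ∈ S, Real.exp (-t / K) * ∏ l, (p (ω l) * Real.exp (Z (ω l) / K)) := by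
        refine Finset.sum_le_sum fun ω hω => ?_
        rw [Finset.prod_mul_distrib, ← Real.exp_sum, mul_left_comm, ← Real.exp_add,
          ← Finset.sum_div, ← add_div]
        refine le_mul_of_one_le_right (Finset.prod_nonneg fun l _ => hp _) (Real.one_le_exp ?_)
        exact div_nonneg (by linarith [hS ω hω]) hK.le
    _ ≤ ∑ ω : Fin s → α, Real.exp (-t / K) * ∏ l, (p (ω l) * Real.exp (Z (ω l) / K)) :=
        Finset.sum_le_sum_of_subset_of_nonneg (Finset.subset_univ S) fun ω _ _ =>
          mul_nonneg (Real.exp_nonneg _)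
            (Finset.prod_nonneg fun l _ => mul_nonneg (hp _) (Real.exp_nonneg _))
    _ = Real.exp (-t / K) * (∑ x, p x * Real.exp (Z x / K)) ^ s := by
        rw [← Finset.mul_sum, Fintype.sum_pow]
    _ ≤ Real.exp (-t / K) * Real.exp (2 * (∑ x, p x * Z x) / K) ^ s := by
        have : 0 ≤ ∑ x, p x * Real.exp (Z x / K) :=
          Finset.sum_nonneg fun x _ => mul_nonneg (hp x) (Real.exp_nonneg _)
        gcongr
    _ = _ := by
        rw [← Real.exp_nat_mul, ← Real.exp_add]
        congr 1
        ring

/-- Lower-tail step in the separation theorem: if `c_{i'j'} < τ/4` and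
`s ≥ 12K‖W‖₁ log(2mn/δ)/τ²`, then `Pr[x_{i'j'}‖W‖₁/s > τ²/2] < δ/(2mn)`. -/
theorem diamond_sampling_lower_tail
    (d m n : ℕ) (hd : 0 < d) (hm : 0 < m) (hn : 0 < n)
    (A : Matrix (Fin d) (Fin m) ℝ) (B : Matrix (Fin d) (Fin n) ℝ)
    (K : ℝ)
    (hA0 : ∀ k i, 0 ≤ A k i) (hAK : ∀ k i, A k i ≤ K)
    (hB0 : ∀ k j, 0 ≤ B k j) (hBK : ∀ k j, B k j ≤ K)
    (W1 : ℝ)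
    (hW1 : W1 = ∑ k : Fin d, ∑ i : Fin m,
        |A k i| * (∑ k' : Fin d, |A k' i|) * (∑ j : Fin n, |B k j|))
    (hW1pos : 0 < W1)
    (hAcol : ∀ i : Fin m, ∃ k : Fin d, A k i ≠ 0)
    (hBrow : ∀ k : Fin d, ∃ j : Fin n, B k j ≠ 0)
    (p : Fin d × Fin m × Fin d × Fin n → ℝ)
    (hp : ∀ (l' : Fin d) (i0 : Fin m) (l : Fin d) (j0 : Fin n),
        p (l', i0, l, j0)
          = ((|A l i0| * (∑ k'' : Fin d, |A k'' i0|) * (∑ j' : Fin n, |B l j'|)) / W1)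
            * (|B l j0| / (∑ j' : Fin n, |B l j'|))
            * (|A l' i0| / (∑ k'' : Fin d, |A k'' i0|)))
    (i' : Fin m) (j' : Fin n)
    (Z : Fin d × Fin m × Fin d × Fin n → ℝ)
    (hZ : ∀ (l' : Fin d) (i0 : Fin m) (l : Fin d) (j0 : Fin n),
        Z (l', i0, l, j0) = if i0 = i' ∧ j0 = j' then B l' j0 else 0)
    (τ δ : ℝ) (hτ : 0 < τ) (hδ0 : 0 < δ) (hδ1 : δ < 1)
    (hcij : (∑ k : Fin d, A k i' * B k j') < τ / 4)
    (s : ℕ)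
    (hs : (s : ℝ) ≥ 12 * K * W1 * Real.log (2 * m * n / δ) / τ ^ 2) :
    (∑ ω ∈ Finset.univ.filter
        (fun ω : Fin s → Fin d × Fin m × Fin d × Fin n =>
          (∑ ℓ : Fin s, Z (ω ℓ)) * W1 / (s : ℝ) > τ ^ 2 / 2),
      ∏ ℓ : Fin s, p (ω ℓ)) < δ / (2 * m * n) := by
  have hA : ∀ i, 0 < ∑ k, |A k i| := fun i => by
    obtain ⟨k, hk⟩ := hAcol i
    exact Finset.sum_pos' (fun _ _ => abs_nonneg _) ⟨k, Finset.mem_univ _, abs_pos.2 hk⟩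
  have hB : ∀ k, 0 < ∑ j, |B k j| := fun k => by
    obtain ⟨j, hj⟩ := hBrow k
    exact Finset.sum_pos' (fun _ _ => abs_nonneg _) ⟨j, Finset.mem_univ _, abs_pos.2 hj⟩
  have hK : 0 < K := by
    obtain ⟨j, hj⟩ := hBrow ⟨0, hd⟩
    exact ((hB0 _ j).lt_of_ne' hj).trans_le (hBK _ j)
  have hp' : ∀ l' i0 l j0, p (l', i0, l, j0) = A l i0 * B l j0 * A l' i0 / W1 := by
    intro l' i0 l j0
    have h1 := (hA i0).ne'
    have h2 := (hB l).ne'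
    rw [hp, ← abs_of_nonneg (hA0 l i0), ← abs_of_nonneg (hB0 l j0), ← abs_of_nonneg (hA0 l' i0)]
    simp only [abs_abs]
    field_simp
  have hp0 : ∀ x, 0 ≤ p x := by
    rintro ⟨l', i0, l, j0⟩
    rw [hp']
    have := hA0 l i0
    have := hB0 l j0
    have := hA0 l' i0
    positivity
  have hp1 : ∑ x, p x = 1 := by
    simp only [Fintype.sum_prod_type, hp', ← Finset.sum_div]
    rw [div_eq_one_iff_eq hW1pos.ne', hW1]
    simp only [abs_of_nonneg (hA0 _ _), abs_of_nonneg (hB0 _ _)]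
    rw [Finset.sum_comm, Finset.sum_comm (s := (Finset.univ : Finset (Fin d)))
      (t := (Finset.univ : Finset (Fin m)))]
    refine Finset.sum_congr rfl fun i _ => ?_
    rw [Finset.sum_comm]
    refine Finset.sum_congr rfl fun l _ => ?_
    simp only [Finset.mul_sum, Finset.sum_mul]
    rw [Finset.sum_comm]
    exact Finset.sum_congr rfl fun j _ => Finset.sum_congr rfl fun l' _ => by ring
  have hZ0 : ∀ x, 0 ≤ Z x := by
    rintro ⟨l', i0, l, j0⟩
    rw [hZ]
    split_ifs
    exacts [hB0 _ _, le_rfl]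
  have hZK : ∀ x, Z x ≤ K := by
    rintro ⟨l', i0, l, j0⟩
    rw [hZ]
    split_ifs
    exacts [hBK _ _, hK.le]
  set c := ∑ k, A k i' * B k j' with hc
  have hc0 : 0 ≤ c := Finset.sum_nonneg fun k _ => mul_nonneg (hA0 _ _) (hB0 _ _)
  have hmean : ∑ x, p x * Z x = c ^ 2 / W1 := by
    simp only [Fintype.sum_prod_type, hp', hZ, ite_and, mul_ite, mul_zero,
      Finset.sum_ite_irrel, Finset.sum_const_zero, Finset.sum_ite_eq', Finset.mem_univ, if_true]
    rw [sq, hc, Finset.sum_mul_sum, Finset.sum_div]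
    refine Finset.sum_congr rfl fun l' _ => ?_
    rw [Finset.sum_div]
    exact Finset.sum_congr rfl fun l _ => by ring
  have hmn : (1 : ℝ) ≤ m * n := by exact_mod_cast Nat.mul_pos hm hn
  have hlog : 0 < Real.log (2 * m * n / δ) :=
    Real.log_pos ((one_lt_div hδ0).2 (by linarith))
  have hs0 : 0 < (s : ℝ) := lt_of_lt_of_le (by positivity) hs
  refine (sum_prod_le_exp_of_le_sum (t := s * τ ^ 2 / (2 * W1)) hp0 hp1 hK hZ0 hZK _
    fun ω hω => ?_).trans_lt ?_
  · have h := (Finset.mem_filter.1 hω).2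
    rw [gt_iff_lt, lt_div_iff₀ hs0] at h
    rw [div_le_iff₀ (by positivity)]
    linarith
  · have hδ : δ / (2 * m * n) = Real.exp (-Real.log (2 * m * n / δ)) := by
      rw [← Real.log_inv, inv_div, Real.exp_log (by positivity)]
    rw [hδ, Real.exp_lt_exp, hmean, div_lt_iff₀ hK]
    have hs' : 12 * K * W1 * Real.log (2 * m * n / δ) ≤ s * τ ^ 2 :=
      (div_le_iff₀ (by positivity)).1 hs
    have hcτ : s * c ^ 2 ≤ s * (τ ^ 2 / 16) :=
      mul_le_mul_of_nonneg_left (by nlinarith) hs0.le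
    have hpos : 0 < K * W1 * Real.log (2 * m * n / δ) := by positivity
    have heq : 2 * s * (c ^ 2 / W1) - s * τ ^ 2 / (2 * W1)
        = (2 * (s * c ^ 2) - s * τ ^ 2 / 2) / W1 := by
      field_simp
    rw [heq, div_lt_iff₀ hW1pos]
    linarith
end

section
/- Fix indices i ∈ [m] and j ∈ [n], and define the random variable Y_{ij} on triples by Y_{ij}(i₀,k,j₀) = sgn(a_{ki}·b_{kj}) if i₀ = i and j₀ = j, and Y_{ij}(i₀,k,j₀) = 0 otherwise. Then the expectation of Y_{ij} under the wedge-sampling distribution equals c_{ij} / ‖w‖₁, where c_{ij} = ∑_{k=1}^d a_{ki}·b_{kj}. -/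
open Finset

theorem sum_abs_ne_zero {ι : Type*} [Fintype ι] {f : ι → ℝ} (hf : ∃ i, f i ≠ 0) :
    ∑ i, |f i| ≠ 0 := by
  obtain ⟨i, hi⟩ := hf
  exact (sum_pos' (fun _ _ => abs_nonneg _) ⟨i, mem_univ i, abs_pos.mpr hi⟩).ne'

/-- The expectation under the wedge-sampling distribution of the single-sample
estimator `Y_{ij}` equals `c_{ij} / ‖w‖₁`. -/
theorem wedge_sampling_expectation
    (d m n : ℕ) (hd : 0 < d) (hm : 0 < m) (hn : 0 < n)
    (A : Matrix (Fin d) (Fin m) ℝ) (B : Matrix (Fin d) (Fin n) ℝ)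
    (w1 : ℝ)
    (hw1 : w1 = ∑ k : Fin d, (∑ i : Fin m, |A k i|) * (∑ j : Fin n, |B k j|))
    (hw1pos : 0 < w1)
    (hArow : ∀ k : Fin d, ∃ i : Fin m, A k i ≠ 0)
    (hBrow : ∀ k : Fin d, ∃ j : Fin n, B k j ≠ 0)
    (p : Fin m × Fin d × Fin n → ℝ)
    (hp : ∀ (i0 : Fin m) (l : Fin d) (j0 : Fin n),
        p (i0, l, j0)
          = (((∑ i' : Fin m, |A l i'|) * (∑ j' : Fin n, |B l j'|)) / w1)
            * (|A l i0| / (∑ i' : Fin m, |A l i'|))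
            * (|B l j0| / (∑ j' : Fin n, |B l j'|)))
    (i : Fin m) (j : Fin n)
    (Y : Fin m × Fin d × Fin n → ℝ)
    (hY : ∀ (i0 : Fin m) (l : Fin d) (j0 : Fin n),
        Y (i0, l, j0) = if i0 = i ∧ j0 = j then sgn (A l i * B l j) else 0) :
    ∑ q : Fin m × Fin d × Fin n, p q * Y q
      = (∑ k : Fin d, A k i * B k j) / w1 := by
  have key (l : Fin d) : p (i, l, j) * sgn (A l i * B l j) = A l i * B l j / w1 := by
    have hA := sum_abs_ne_zero (hArow l)
    have hB := sum_abs_ne_zero (hBrow l)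
    have hpl : p (i, l, j) = |A l i * B l j| / w1 := by
      rw [hp, abs_mul]
      field_simp
    rw [hpl, div_mul_eq_mul_div, abs_mul_sgn]
  rw [Fintype.sum_prod_type, sum_eq_single i, Fintype.sum_prod_type, sum_div]
  · refine sum_congr rfl fun l _ => ?_
    rw [sum_eq_single j]
    · rw [hY, if_pos ⟨rfl, rfl⟩, key]
    · intro j0 _ hj0
      rw [hY, if_neg (fun h => hj0 h.2), mul_zero]
    · simp
  · rintro i0 - hi0
    refine sum_eq_zero fun q _ => ?_
    rw [hY, if_neg (fun h => hi0 h.1), mul_zero]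
  · simp
end

section
/- Let A ∈ {0,1}^{d×m} and B ∈ {0,1}^{d×n} be binary matrices with ‖W‖₁ > 0, every column of A nonzero, and every row of B nonzero. Then the diamond-sampling distribution is the uniform distribution on the set of three-paths: for every quadruple (k',i,k,j), its probability equals 1/‖W‖₁ if a_{ki} = b_{kj} = a_{k'i} = 1, and 0 otherwise. Consequently, conditioned on the sampled three-path closing into a diamond (i.e., additionally b_{k'j} = 1), the conditional distribution is uniform over the set of all diamonds. -/
open Finset
open scoped Classical

/-- For binary matrices, diamond sampling is uniform on three-paths: each
quadruple `(k', i, k, j)` has probability `1/‖W‖₁` if it is a three-path and `0`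
otherwise.  Consequently, conditioned on the sampled three-path closing into a
diamond, the conditional distribution is uniform over the set of diamonds. -/
theorem binary_diamond_sampling_uniform
    (d m n : ℕ) (hd : 0 < d) (hm : 0 < m) (hn : 0 < n)
    (A : Matrix (Fin d) (Fin m) ℝ) (B : Matrix (Fin d) (Fin n) ℝ)
    (hA : ∀ k i, A k i = 0 ∨ A k i = 1)
    (hB : ∀ k j, B k j = 0 ∨ B k j = 1)
    (W1 : ℝ)
    (hW1 : W1 = ∑ k : Fin d, ∑ i : Fin m,
        |A k i| * (∑ k' : Fin d, |A k' i|) * (∑ j : Fin n, |B k j|))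
    (hW1pos : 0 < W1)
    (hAcol : ∀ i : Fin m, ∃ k : Fin d, A k i ≠ 0)
    (hBrow : ∀ k : Fin d, ∃ j : Fin n, B k j ≠ 0)
    (p : Fin d × Fin m × Fin d × Fin n → ℝ)
    (hp : ∀ (l' : Fin d) (i0 : Fin m) (l : Fin d) (j0 : Fin n),
        p (l', i0, l, j0)
          = ((|A l i0| * (∑ k'' : Fin d, |A k'' i0|) * (∑ j' : Fin n, |B l j'|)) / W1)
            * (|B l j0| / (∑ j' : Fin n, |B l j'|))
            * (|A l' i0| / (∑ k'' : Fin d, |A k'' i0|)))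
    (D : Fin d × Fin m × Fin d × Fin n → Prop)
    (hD : ∀ (l' : Fin d) (i0 : Fin m) (l : Fin d) (j0 : Fin n),
        D (l', i0, l, j0) ↔
          (A l i0 = 1 ∧ B l j0 = 1 ∧ A l' i0 = 1 ∧ B l' j0 = 1)) :
    (∀ (l' : Fin d) (i0 : Fin m) (l : Fin d) (j0 : Fin n),
        p (l', i0, l, j0)
          = if A l i0 = 1 ∧ B l j0 = 1 ∧ A l' i0 = 1 then 1 / W1 else 0)
    ∧ (∀ q : Fin d × Fin m × Fin d × Fin n, D q →
        p q / (∑ q' ∈ Finset.univ.filter D, p q')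
          = 1 / ((Finset.univ.filter D).card : ℝ)) := by
  have hsum_ne : ∀ {ι : Type} [Fintype ι] (f : ι → ℝ), (∃ x, f x ≠ 0) → ∑ x, |f x| ≠ 0 := by
    rintro ι _ f ⟨x, hx⟩
    exact (Finset.sum_pos' (fun y _ => abs_nonneg (f y))
      ⟨x, Finset.mem_univ x, abs_pos.mpr hx⟩).ne'
  have hunif : ∀ (l' : Fin d) (i0 : Fin m) (l : Fin d) (j0 : Fin n),
      p (l', i0, l, j0) = if A l i0 = 1 ∧ B l j0 = 1 ∧ A l' i0 = 1 then 1 / W1 else 0 := by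
    intro l' i0 l j0
    have hcol := hsum_ne (fun k => A k i0) (hAcol i0)
    have hrow := hsum_ne (fun j => B l j) (hBrow l)
    rw [hp]
    rcases hA l i0 with h1 | h1
    · simp [h1]
    rcases hB l j0 with h2 | h2
    · simp [h2]
    rcases hA l' i0 with h3 | h3
    · simp [h3]
    rw [h1, h2, h3, if_pos ⟨rfl, rfl, rfl⟩, abs_one]
    field_simp
  have hdiamond : ∀ q, D q → p q = 1 / W1 := by
    rintro ⟨l', i0, l, j0⟩ hq
    obtain ⟨h1, h2, h3, -⟩ := (hD l' i0 l j0).mp hq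
    rw [hunif, if_pos ⟨h1, h2, h3⟩]
  refine ⟨hunif, fun q hq => ?_⟩
  have hcard : ((Finset.univ.filter D).card : ℝ) ≠ 0 :=
    Nat.cast_ne_zero.mpr
      (Finset.card_ne_zero_of_mem (Finset.mem_filter.mpr ⟨Finset.mem_univ q, hq⟩))
  rw [hdiamond q hq,
    Finset.sum_congr rfl fun q' hq' => hdiamond q' (Finset.mem_filter.mp hq').2,
    Finset.sum_const, nsmul_eq_mul]
  have hW1ne := hW1pos.ne'
  field_simp
end

section
/- Let A ∈ {0,1}^{d×m} and B ∈ {0,1}^{d×n} be binary matrices with ‖W‖₁ > 0, every column of A nonzero, and every row of B nonzero. Then the probability under the diamond-sampling distribution that the sampled three-path (k',i,k,j) closes into a diamond (i.e., b_{k'j} = 1) equals (∑_{i,j} c_{ij}²) / ‖W‖₁, where c_{ij} = ∑_{k=1}^d a_{ki}·b_{kj}; that is, the closure probability equals the squared Frobenius norm of C = AᵀB divided by the number of three-paths. -/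
open Finset
open scoped Classical

/-- For binary matrices, the probability under the diamond-sampling distribution
that the sampled three-path `(k', i, k, j)` closes into a diamond (i.e.,
`b_{k'j} = 1`) equals `(∑_{i,j} c_{ij}²) / ‖W‖₁`. -/
theorem binary_diamond_closure_prob
    (d m n : ℕ) (hd : 0 < d) (hm : 0 < m) (hn : 0 < n)
    (A : Matrix (Fin d) (Fin m) ℝ) (B : Matrix (Fin d) (Fin n) ℝ)
    (hA : ∀ k i, A k i = 0 ∨ A k i = 1)
    (hB : ∀ k j, B k j = 0 ∨ B k j = 1)
    (W1 : ℝ)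
    (hW1 : W1 = ∑ k : Fin d, ∑ i : Fin m,
        |A k i| * (∑ k' : Fin d, |A k' i|) * (∑ j : Fin n, |B k j|))
    (hW1pos : 0 < W1)
    (hAcol : ∀ i : Fin m, ∃ k : Fin d, A k i ≠ 0)
    (hBrow : ∀ k : Fin d, ∃ j : Fin n, B k j ≠ 0)
    (p : Fin d × Fin m × Fin d × Fin n → ℝ)
    (hp : ∀ (l' : Fin d) (i0 : Fin m) (l : Fin d) (j0 : Fin n),
        p (l', i0, l, j0)
          = ((|A l i0| * (∑ k'' : Fin d, |A k'' i0|) * (∑ j' : Fin n, |B l j'|)) / W1)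
            * (|B l j0| / (∑ j' : Fin n, |B l j'|))
            * (|A l' i0| / (∑ k'' : Fin d, |A k'' i0|))) :
    (∑ q ∈ Finset.univ.filter
        (fun q : Fin d × Fin m × Fin d × Fin n => B q.1 q.2.2.2 = 1), p q)
      = (∑ i : Fin m, ∑ j : Fin n, (∑ k : Fin d, A k i * B k j) ^ 2) / W1 := by
  have hAabs : ∀ k i, |A k i| = A k i := fun k i => by
    rcases hA k i with h | h <;> simp [h]
  have hBabs : ∀ k j, |B k j| = B k j := fun k j => by
    rcases hB k j with h | h <;> simp [h]
  have hAsum : ∀ i, (∑ k, |A k i|) ≠ 0 := fun i => by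
    obtain ⟨k, hk⟩ := hAcol i
    exact (Finset.sum_pos' (fun _ _ => abs_nonneg _)
      ⟨k, Finset.mem_univ k, abs_pos.mpr hk⟩).ne'
  have hBsum : ∀ k, (∑ j, |B k j|) ≠ 0 := fun k => by
    obtain ⟨j, hj⟩ := hBrow k
    exact (Finset.sum_pos' (fun _ _ => abs_nonneg _)
      ⟨j, Finset.mem_univ j, abs_pos.mpr hj⟩).ne'
  have hterm : ∀ l' i l j, (if B l' j = 1 then p (l', i, l, j) else 0)
      = A l' i * B l' j * (A l i * B l j) / W1 := fun l' i l j => by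
    have hpath : p (l', i, l, j) = A l' i * (A l i * B l j) / W1 := by
      have h1 := hAsum i
      have h2 := hBsum l
      have h3 := hW1pos.ne'
      rw [hp, hAabs l i, hAabs l' i, hBabs l j]
      field_simp
    rcases hB l' j with h | h <;> simp [h, hpath]
  rw [Finset.sum_filter]
  simp only [Fintype.sum_prod_type, hterm, sq, Finset.sum_mul_sum, Finset.sum_div]
  rw [Finset.sum_comm]
  refine Finset.sum_congr rfl fun i _ => ?_
  conv_rhs => rw [Finset.sum_comm]
  exact Finset.sum_congr rfl fun l' _ => Finset.sum_comm
end
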